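/- arXiv:2408.13278 — 3 statements merged into one kernel-verified Lean document; each statement's English description precedes it below -/
import Mathlib

section
/- Let Y be a finite set and let q1, q2 be probability mass functions on Y with TV(q1, q2) < 1. Define Z = Σ_y min(q1(y), q2(y)) and the CP-Δ output distribution p(y) = min(q1(y), q2(y)) / Z, which is a probability mass function. Then for each i ∈ {1, 2}, Δ_max(p ‖ q_i) ≤ −log(1 − TV(q1, q2)); that is, the CP-Δ model with the min combination is k-NAF with respect to the safe models {q1, q2} and divergence Δ_max, for k = −log(1 − TV(q1, q2)). -/
/-- The overlap of two probability mass functions is one minus their total variation distance. -/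
lemma sum_min_eq_one_sub_tv {Y : Type*} [Fintype Y] (q1 q2 : Y → ℝ)
    (hq1s : ∑ y, q1 y = 1) (hq2s : ∑ y, q2 y = 1) :
    ∑ y, min (q1 y) (q2 y) = 1 - (1 / 2) * ∑ y, |q1 y - q2 y| := by
  have hmin (y : Y) : min (q1 y) (q2 y) = (1 / 2) * (q1 y + q2 y - |q1 y - q2 y|) := by
    linarith [min_add_max (q1 y) (q2 y), max_sub_min_eq_abs' (q1 y) (q2 y)]
  simp only [hmin]
  rw [← Finset.mul_sum, Finset.sum_sub_distrib, Finset.sum_add_distrib, hq1s, hq2s]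
  ring

/-- Normalizing a mass `m ≤ q` by `Z` raises the log-ratio against `q` to at most `-log Z`. -/
lemma log_div_div_le_neg_log {m q Z : ℝ} (hZ : 0 < Z) (hm : 0 < m / Z) (hmq : m ≤ q) :
    Real.log (m / Z / q) ≤ -Real.log Z := by
  have hm0 : 0 < m := (div_pos_iff_of_pos_right hZ).1 hm
  have hq : 0 < q := hm0.trans_le hmq
  rw [← Real.log_inv]
  refine Real.log_le_log (div_pos hm hq) ?_
  rw [div_right_comm, inv_eq_one_div]
  gcongr
  exact (div_le_one hq).2 hmq


/-- CP-Δ with the min-combination rule: if `TV(q1, q2) < 1`, `Z = ∑ y, min (q1 y) (q2 y)`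
and `p y = min (q1 y) (q2 y) / Z`, then `p` is a pmf and for each `i ∈ {1, 2}`,
`Δ_max(p ‖ q_i) ≤ -log (1 - TV(q1, q2))`, i.e. `p` is `k`-NAF w.r.t. the safe models
`{q1, q2}` and `Δ_max` for `k = -log (1 - TV(q1, q2))`. -/
theorem cpDelta_min_naf {Y : Type*} [Fintype Y] (q1 q2 : Y → ℝ)
    (hq1 : ∀ y, 0 ≤ q1 y) (hq1s : ∑ y, q1 y = 1)
    (hq2 : ∀ y, 0 ≤ q2 y) (hq2s : ∑ y, q2 y = 1)
    (hTV : (1 / 2) * ∑ y, |q1 y - q2 y| < 1)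
    (Z : ℝ) (hZ : Z = ∑ y, min (q1 y) (q2 y))
    (p : Y → ℝ) (hp : ∀ y, p y = min (q1 y) (q2 y) / Z) :
    ((∀ y, 0 ≤ p y) ∧ ∑ y, p y = 1) ∧
    (∀ y, 0 < p y →
      Real.log (p y / q1 y) ≤ -Real.log (1 - (1 / 2) * ∑ y, |q1 y - q2 y|)) ∧
    (∀ y, 0 < p y →
      Real.log (p y / q2 y) ≤ -Real.log (1 - (1 / 2) * ∑ y, |q1 y - q2 y|)) := by
  have hZTV : Z = 1 - (1 / 2) * ∑ y, |q1 y - q2 y| :=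
    hZ.trans (sum_min_eq_one_sub_tv q1 q2 hq1s hq2s)
  have hZpos : 0 < Z := by linarith
  rw [← hZTV]
  simp only [hp]
  refine ⟨⟨fun y => div_nonneg (le_min (hq1 y) (hq2 y)) hZpos.le, ?_⟩,
    fun y hy => log_div_div_le_neg_log hZpos hy (min_le_left _ _),
    fun y hy => log_div_div_le_neg_log hZpos hy (min_le_right _ _)⟩
  rw [← Finset.sum_div, ← hZ, div_self hZpos.ne']
end

section
/- Let Y be a finite set and let q1, q2 be probability mass functions on Y with H²(q1, q2) < 1. Define Z = Σ_y √(q1(y) · q2(y)) and the CP-Δ output distribution p(y) = √(q1(y) · q2(y)) / Z, which is a probability mass function. Then for each i ∈ {1, 2}, Δ_KL(p ‖ q_i) ≤ −2 log(1 − H²(q1, q2)); that is, the CP-Δ model with the geometric-mean combination is k-NAF with respect to the safe models {q1, q2} and divergence Δ_KL, for k = −2 log(1 − H²(q1, q2)). -/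
theorem sub_le_mul_log_div {x q : ℝ} (hx : 0 ≤ x) (hq : 0 ≤ q) (h : q = 0 → x = 0) :
    x - q ≤ x * Real.log (x / q) := by
  rcases hx.eq_or_lt with rfl | hx
  · simpa using hq
  have hq' : 0 < q := hq.lt_of_ne fun h0 => hx.ne' (h h0.symm)
  have hlog := Real.one_sub_inv_le_log_of_pos (div_pos hx hq')
  calc x - q = x * (1 - (x / q)⁻¹) := by field_simp
    _ ≤ x * Real.log (x / q) := mul_le_mul_of_nonneg_left hlog hx.le

/-- Gibbs' inequality for probability mass functions on a finite type. -/
theorem sum_mul_log_div_nonneg {Y : Type*} [Fintype Y] {p q : Y → ℝ}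
    (hp : ∀ y, 0 ≤ p y) (hq : ∀ y, 0 ≤ q y) (hsum : ∑ y, p y = ∑ y, q y)
    (hac : ∀ y, q y = 0 → p y = 0) : 0 ≤ ∑ y, p y * Real.log (p y / q y) :=
  calc 0 = ∑ y, (p y - q y) := by rw [Finset.sum_sub_distrib, hsum, sub_self]
    _ ≤ _ := Finset.sum_le_sum fun y _ => sub_le_mul_log_div (hp y) (hq y) (hac y)

/-- The Hellinger affinity is one minus the squared Hellinger distance. -/
theorem one_sub_half_sum_sqrt_sub_sq {Y : Type*} [Fintype Y] {q1 q2 : Y → ℝ}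
    (hq1 : ∀ y, 0 ≤ q1 y) (hq1s : ∑ y, q1 y = 1)
    (hq2 : ∀ y, 0 ≤ q2 y) (hq2s : ∑ y, q2 y = 1) :
    1 - (1 / 2) * ∑ y, (Real.sqrt (q1 y) - Real.sqrt (q2 y)) ^ 2
      = ∑ y, Real.sqrt (q1 y * q2 y) := by
  have h : ∀ y, (Real.sqrt (q1 y) - Real.sqrt (q2 y)) ^ 2
      = q1 y + q2 y - 2 * Real.sqrt (q1 y * q2 y) := fun y => by
    rw [sub_sq, Real.sq_sqrt (hq1 y), Real.sq_sqrt (hq2 y), Real.sqrt_mul (hq1 y)]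
    ring
  simp_rw [h]
  rw [Finset.sum_sub_distrib, Finset.sum_add_distrib, hq1s, hq2s, ← Finset.mul_sum]
  ring

theorem mul_log_div_add_mul_log_div {a b Z : ℝ} (ha : 0 ≤ a) (hb : 0 ≤ b) (hZ : 0 < Z) :
    Real.sqrt (a * b) / Z * Real.log (Real.sqrt (a * b) / Z / a)
      + Real.sqrt (a * b) / Z * Real.log (Real.sqrt (a * b) / Z / b)
      = Real.sqrt (a * b) / Z * (-2 * Real.log Z) := by
  rcases ha.eq_or_lt with rfl | ha
  · simp
  rcases hb.eq_or_lt with rfl | hb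
  · simp
  have hs : Real.sqrt (a * b) ≠ 0 := (Real.sqrt_pos.2 (mul_pos ha hb)).ne'
  rw [Real.log_div (div_ne_zero hs hZ.ne') ha.ne', Real.log_div (div_ne_zero hs hZ.ne') hb.ne',
    Real.log_div hs hZ.ne', Real.log_sqrt (mul_pos ha hb).le, Real.log_mul ha.ne' hb.ne']
  ring


/-- CP-Δ with the geometric-mean combination rule: if `H²(q1, q2) < 1`,
`Z = ∑ y, √(q1 y * q2 y)` and `p y = √(q1 y * q2 y) / Z`, then `p` is a pmf and for
each `i ∈ {1, 2}`, `Δ_KL(p ‖ q_i) ≤ -2 log (1 - H²(q1, q2))`, i.e. `p` is `k`-NAF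
w.r.t. the safe models `{q1, q2}` and `Δ_KL` for `k = -2 log (1 - H²(q1, q2))`.
(The convention `0 * log 0 = 0` holds automatically for real arithmetic in Lean.) -/
theorem cpDelta_sqrt_naf {Y : Type*} [Fintype Y] (q1 q2 : Y → ℝ)
    (hq1 : ∀ y, 0 ≤ q1 y) (hq1s : ∑ y, q1 y = 1)
    (hq2 : ∀ y, 0 ≤ q2 y) (hq2s : ∑ y, q2 y = 1)
    (hH : (1 / 2) * ∑ y, (Real.sqrt (q1 y) - Real.sqrt (q2 y)) ^ 2 < 1)
    (Z : ℝ) (hZ : Z = ∑ y, Real.sqrt (q1 y * q2 y))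
    (p : Y → ℝ) (hp : ∀ y, p y = Real.sqrt (q1 y * q2 y) / Z) :
    ((∀ y, 0 ≤ p y) ∧ ∑ y, p y = 1) ∧
    (∑ y, p y * Real.log (p y / q1 y)
      ≤ -2 * Real.log (1 - (1 / 2) * ∑ y, (Real.sqrt (q1 y) - Real.sqrt (q2 y)) ^ 2)) ∧
    (∑ y, p y * Real.log (p y / q2 y)
      ≤ -2 * Real.log (1 - (1 / 2) * ∑ y, (Real.sqrt (q1 y) - Real.sqrt (q2 y)) ^ 2)) := by
  have hHZ := one_sub_half_sum_sqrt_sub_sq hq1 hq1s hq2 hq2s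
  rw [← hZ] at hHZ
  have hZpos : 0 < Z := by linarith
  have hp0 : ∀ y, 0 ≤ p y := fun y => by
    rw [hp]
    positivity
  have hps : ∑ y, p y = 1 := by
    simp_rw [hp]
    rw [← Finset.sum_div, ← hZ, div_self hZpos.ne']
  have hsum : ∑ y, p y * Real.log (p y / q1 y) + ∑ y, p y * Real.log (p y / q2 y)
      = -2 * Real.log Z := by
    rw [← Finset.sum_add_distrib, ← one_mul (-2 * Real.log Z), ← hps, Finset.sum_mul]
    refine Finset.sum_congr rfl fun y _ => ?_
    rw [hp]
    exact mul_log_div_add_mul_log_div (hq1 y) (hq2 y) hZpos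
  have h1 := sum_mul_log_div_nonneg hp0 hq1 (hps.trans hq1s.symm) fun y h => by simp [hp, h]
  have h2 := sum_mul_log_div_nonneg hp0 hq2 (hps.trans hq2s.symm) fun y h => by simp [hp, h]
  rw [hHZ]
  exact ⟨⟨hp0, hps⟩, by linarith, by linarith⟩
end

section
/- Let Y be a finite set and let q1, q2 be probability mass functions on Y with H²(q1, q2) < 1, with q1(y) > 0 and q2(y) > 0 for all y in the support of p, where Z = Σ_y √(q1(y) · q2(y)) and p(y) = √(q1(y) · q2(y)) / Z. Then the sum of the two KL divergences satisfies the exact identity Δ_KL(p ‖ q1) + Δ_KL(p ‖ q2) = −2 log Z = −2 log(1 − H²(q1, q2)). -/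
/-- The Bhattacharyya coefficient of two probability mass functions is one minus their squared
Hellinger distance. -/
theorem sum_sqrt_mul_eq_one_sub_hellinger {Y : Type*} [Fintype Y] {q1 q2 : Y → ℝ}
    (hq1 : ∀ y, 0 ≤ q1 y) (hq1s : ∑ y, q1 y = 1)
    (hq2 : ∀ y, 0 ≤ q2 y) (hq2s : ∑ y, q2 y = 1) :
    ∑ y, Real.sqrt (q1 y * q2 y)
      = 1 - (1 / 2) * ∑ y, (Real.sqrt (q1 y) - Real.sqrt (q2 y)) ^ 2 := by
  have h : ∀ y, (Real.sqrt (q1 y) - Real.sqrt (q2 y)) ^ 2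
      = q1 y + q2 y - 2 * Real.sqrt (q1 y * q2 y) := fun y => by
    rw [Real.sqrt_mul (hq1 y), sub_sq, Real.sq_sqrt (hq1 y), Real.sq_sqrt (hq2 y)]
    ring
  simp only [h, Finset.sum_sub_distrib, Finset.sum_add_distrib, ← Finset.mul_sum, hq1s, hq2s]
  ring

/-- The logarithms of the ratios of the normalized geometric mean of `a` and `b` to `a` and to `b`
add up to `-2 log Z`. -/
theorem log_geom_mean_div_add_log_geom_mean_div {a b Z : ℝ} (ha : 0 < a) (hb : 0 < b)
    (hZ : 0 < Z) :
    Real.log (Real.sqrt (a * b) / Z / a) + Real.log (Real.sqrt (a * b) / Z / b)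
      = -2 * Real.log Z := by
  have hs : Real.sqrt (a * b) ≠ 0 := (Real.sqrt_pos.2 (mul_pos ha hb)).ne'
  rw [Real.log_div (div_ne_zero hs hZ.ne') ha.ne', Real.log_div (div_ne_zero hs hZ.ne') hb.ne',
    Real.log_div hs hZ.ne', Real.log_sqrt (mul_pos ha hb).le, Real.log_mul ha.ne' hb.ne']
  ring

/-- Exact identity for the geometric-mean CP-Δ model: if `H²(q1, q2) < 1`, `q1` and `q2`
are positive on the support of `p`, `Z = ∑ y, √(q1 y * q2 y)` and
`p y = √(q1 y * q2 y) / Z`, then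
`Δ_KL(p ‖ q1) + Δ_KL(p ‖ q2) = -2 log Z = -2 log (1 - H²(q1, q2))`. -/
theorem cpDelta_sqrt_kl_identity {Y : Type*} [Fintype Y] (q1 q2 : Y → ℝ)
    (hq1 : ∀ y, 0 ≤ q1 y) (hq1s : ∑ y, q1 y = 1)
    (hq2 : ∀ y, 0 ≤ q2 y) (hq2s : ∑ y, q2 y = 1)
    (hH : (1 / 2) * ∑ y, (Real.sqrt (q1 y) - Real.sqrt (q2 y)) ^ 2 < 1)
    (Z : ℝ) (hZ : Z = ∑ y, Real.sqrt (q1 y * q2 y))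
    (p : Y → ℝ) (hp : ∀ y, p y = Real.sqrt (q1 y * q2 y) / Z)
    (hsupp : ∀ y, 0 < p y → 0 < q1 y ∧ 0 < q2 y) :
    (∑ y, p y * Real.log (p y / q1 y)) + (∑ y, p y * Real.log (p y / q2 y))
      = -2 * Real.log Z ∧
    -2 * Real.log Z
      = -2 * Real.log (1 - (1 / 2) * ∑ y, (Real.sqrt (q1 y) - Real.sqrt (q2 y)) ^ 2) := by
  have hZH := hZ.trans (sum_sqrt_mul_eq_one_sub_hellinger hq1 hq1s hq2 hq2s)
  have hZpos : 0 < Z := by linarith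
  have hps : ∑ y, p y = 1 := by
    simp only [hp, ← Finset.sum_div, ← hZ, div_self hZpos.ne']
  refine ⟨?_, by rw [← hZH]⟩
  have hterm : ∀ y, p y * Real.log (p y / q1 y) + p y * Real.log (p y / q2 y)
      = p y * (-2 * Real.log Z) := fun y => by
    have hp0 : 0 ≤ p y := by rw [hp]; positivity
    rcases hp0.eq_or_lt with h0 | hpos
    · simp [← h0]
    · obtain ⟨h1, h2⟩ := hsupp y hpos
      rw [← mul_add, hp, log_geom_mean_div_add_log_geom_mean_div h1 h2 hZpos]
  rw [← Finset.sum_add_distrib, Finset.sum_congr rfl fun y _ => hterm y, ← Finset.sum_mul, hps,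
    one_mul]
end
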